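/- arXiv:hep-th/0512054 — 2 statements merged into one kernel-verified Lean document; each statement's English description precedes it below -/
import Mathlib

section
/- Let L² be the Hilbert space of square-integrable functions on the circle (AddCircle (2π)), let H² (the Hardy space) be the topological closure of the linear span of the Fourier characters φₙ = fourier n for n ≥ 0, and let P₊ : L² →L[ℂ] L² be the orthogonal projection onto H². For a continuous function f on the circle, let M_f denote the bounded multiplication operator on L², and let T_f := P₊ ∘ M_f ∘ P₊ be the associated Toeplitz operator (compressed to act on L² through P₊). Then for all continuous functions f and g on the circle, the semicommutator T_f ∘ T_g − P₊ ∘ M_{f·g} ∘ P₊ is a compact operator on L². (Hence the map f ↦ T_f is an algebra homomorphism modulo compact operators, and the Toeplitz algebra is an extension of C(S¹) by the compacts.) -/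
open MeasureTheory AddCircle ContinuousLinearMap

instance : Fact (0 < 2 * Real.pi) := ⟨Real.two_pi_pos⟩

/-- The Hilbert space `L²` of the circle `ℝ/2πℤ` (with normalized Haar measure). -/
noncomputable abbrev CircleL2 : Type :=
  Lp ℂ 2 (haarAddCircle (T := 2 * Real.pi))

/-- The Hardy space `H²`: the closure in `L²` of the span of the Fourier characters
`fourier n` with `n ≥ 0`. -/
noncomputable def hardySpace : Submodule ℂ CircleL2 :=
  (Submodule.span ℂ
    (Set.range fun n : ℕ => (fourierLp (T := 2 * Real.pi) 2 (n : ℤ)))).topologicalClosure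

/-- An operator whose values lie in a finite-dimensional subspace is compact. -/
theorem isCompactOperator_of_forall_mem_finiteDimensional {E F : Type*}
    [NormedAddCommGroup E] [NormedSpace ℂ E] [NormedAddCommGroup F] [NormedSpace ℂ F]
    (A : E →L[ℂ] F) (V : Submodule ℂ F) [FiniteDimensional ℂ V] (hA : ∀ x, A x ∈ V) :
    IsCompactOperator A :=
  have : ProperSpace V := FiniteDimensional.proper ℂ V
  (isCompactOperator_of_locallyCompactSpace_dom (A.codRestrict V hA)).clm_comp V.subtypeL

theorem fourierLp_mem_hardySpace {n : ℤ} (hn : 0 ≤ n) :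
    fourierLp (T := 2 * Real.pi) 2 n ∈ hardySpace := by
  lift n to ℕ using hn
  exact Submodule.le_topologicalClosure _ (Submodule.subset_span ⟨n, rfl⟩)

theorem fourierLp_mem_hardySpace_orthogonal {n : ℤ} (hn : n < 0) :
    fourierLp (T := 2 * Real.pi) 2 n ∈ hardySpaceᗮ := by
  rw [hardySpace, Submodule.orthogonal_closure, Submodule.mem_orthogonal]
  intro u hu
  induction hu using Submodule.span_induction with
  | mem x hx =>
    obtain ⟨k, rfl⟩ := hx
    exact orthonormal_fourier.2 (by omega)
  | zero => exact inner_zero_left _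
  | add x y _ _ hx hy => rw [inner_add_left, hx, hy, add_zero]
  | smul c x _ hx => rw [inner_smul_left, hx, mul_zero]

/-- `P` is the orthogonal projection onto the Hardy space. -/
structure IsHardyProjection (P : CircleL2 →L[ℂ] CircleL2) : Prop where
  apply_of_mem : ∀ x ∈ hardySpace, P x = x
  apply_of_mem_orthogonal : ∀ x ∈ hardySpaceᗮ, P x = 0

namespace IsHardyProjection

variable {P : CircleL2 →L[ℂ] CircleL2}

theorem apply_apply (hP : IsHardyProjection P) (x : CircleL2) : P (P x) = P x := by
  have : CompleteSpace hardySpace :=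
    (Submodule.isClosed_topologicalClosure _).completeSpace_coe
  obtain ⟨y, hy, z, hz, rfl⟩ := hardySpace.exists_add_mem_mem_orthogonal x
  rw [map_add, hP.apply_of_mem y hy, hP.apply_of_mem_orthogonal z hz, add_zero,
    hP.apply_of_mem y hy]

theorem apply_fourierLp_of_nonneg (hP : IsHardyProjection P) {n : ℤ} (hn : 0 ≤ n) :
    P (fourierLp 2 n) = fourierLp 2 n :=
  hP.apply_of_mem _ (fourierLp_mem_hardySpace hn)

theorem apply_fourierLp_of_neg (hP : IsHardyProjection P) {n : ℤ} (hn : n < 0) :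
    P (fourierLp 2 n) = 0 :=
  hP.apply_of_mem_orthogonal _ (fourierLp_mem_hardySpace_orthogonal hn)

end IsHardyProjection

/-- `M f` is the operator of multiplication by `f` on `L²`, for every continuous `f`. -/
def IsMultiplication (M : C(AddCircle (2 * Real.pi), ℂ) → (CircleL2 →L[ℂ] CircleL2)) : Prop :=
  ∀ (f : C(AddCircle (2 * Real.pi), ℂ)) (g : CircleL2),
    (M f g : AddCircle (2 * Real.pi) → ℂ)
      =ᵐ[haarAddCircle (T := 2 * Real.pi)] fun x => f x * g x

namespace IsMultiplication

variable {M : C(AddCircle (2 * Real.pi), ℂ) → (CircleL2 →L[ℂ] CircleL2)}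

theorem map_add (hM : IsMultiplication M) (f g : C(AddCircle (2 * Real.pi), ℂ)) :
    M (f + g) = M f + M g := by
  ext1 u
  refine Lp.ext ?_
  filter_upwards [hM (f + g) u, hM f u, hM g u, Lp.coeFn_add (M f u) (M g u)] with x h hf hg ha
  rw [h, add_apply (M f) (M g) u, ha, Pi.add_apply, hf, hg, ContinuousMap.add_apply, add_mul]

theorem map_smul (hM : IsMultiplication M) (c : ℂ) (f : C(AddCircle (2 * Real.pi), ℂ)) :
    M (c • f) = c • M f := by
  ext1 u
  refine Lp.ext ?_
  filter_upwards [hM (c • f) u, hM f u, Lp.coeFn_smul c (M f u)] with x h hf hc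
  rw [h, smul_apply (M f) c u, hc, Pi.smul_apply, hf, ContinuousMap.smul_apply,
    smul_eq_mul, smul_eq_mul, mul_assoc]

theorem map_mul_apply (hM : IsMultiplication M) (f g : C(AddCircle (2 * Real.pi), ℂ))
    (u : CircleL2) : M (f * g) u = M f (M g u) := by
  refine Lp.ext ?_
  filter_upwards [hM (f * g) u, hM f (M g u), hM g u] with x h hf hg
  rw [h, hf, hg, ContinuousMap.mul_apply, mul_assoc]

theorem norm_le (hM : IsMultiplication M) (f : C(AddCircle (2 * Real.pi), ℂ)) :
    ‖M f‖ ≤ ‖f‖ := by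
  refine ContinuousLinearMap.opNorm_le_bound _ (norm_nonneg f) fun u => ?_
  refine Lp.norm_le_mul_norm_of_ae_le_mul ?_
  filter_upwards [hM f u] with x hx
  rw [hx, norm_mul]
  gcongr
  exact f.norm_coe_le_norm x

/-- Multiplication operators depend linearly and continuously on their symbol. -/
noncomputable def toContinuousLinearMap (hM : IsMultiplication M) :
    C(AddCircle (2 * Real.pi), ℂ) →L[ℂ] CircleL2 →L[ℂ] CircleL2 :=
  LinearMap.mkContinuous { toFun := M, map_add' := hM.map_add, map_smul' := hM.map_smul } 1
    fun f => by simpa using hM.norm_le f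

theorem fourier_fourierLp (hM : IsMultiplication M) (m n : ℤ) :
    M (fourier m) (fourierLp 2 n) = fourierLp 2 (m + n) := by
  refine Lp.ext ?_
  filter_upwards [hM (fourier m) (fourierLp 2 n), coeFn_fourierLp 2 n, coeFn_fourierLp 2 (m + n)]
    with x h hn hmn
  rw [h, hn, hmn, fourier_add]

end IsMultiplication

/-- The Hankel operator with symbol a Fourier character has finite rank. -/
theorem isCompactOperator_hankel_fourier {P : CircleL2 →L[ℂ] CircleL2}
    {M : C(AddCircle (2 * Real.pi), ℂ) → (CircleL2 →L[ℂ] CircleL2)}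
    (hP : IsHardyProjection P) (hM : IsMultiplication M) (n : ℤ) :
    IsCompactOperator ((ContinuousLinearMap.id ℂ CircleL2 - P) ∘L M (fourier n) ∘L P) := by
  set A := (ContinuousLinearMap.id ℂ CircleL2 - P) ∘L M (fourier n) ∘L P with hA
  let V : Submodule ℂ CircleL2 := Submodule.span ℂ (fourierLp 2 '' Set.Ico n 0)
  have : FiniteDimensional ℂ V :=
    FiniteDimensional.span_of_finite ℂ ((Set.finite_Ico n 0).image _)
  refine isCompactOperator_of_forall_mem_finiteDimensional A V fun x => ?_
  have hV : IsClosed (V.comap A.toLinearMap : Set CircleL2) :=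
    V.closed_of_finiteDimensional.preimage A.continuous
  have hspan : Submodule.span ℂ (Set.range (fourierLp 2)) ≤ V.comap A.toLinearMap := by
    rw [Submodule.span_le]
    rintro _ ⟨k, rfl⟩
    change A (fourierLp 2 k) ∈ V
    obtain hk | hk := lt_or_ge k 0
    · simp [hA, hP.apply_fourierLp_of_neg hk]
    have hAk : A (fourierLp 2 k) = fourierLp 2 (n + k) - P (fourierLp 2 (n + k)) := by
      simp only [hA, comp_apply, sub_apply, id_apply, hP.apply_fourierLp_of_nonneg hk,
        hM.fourier_fourierLp]
    rw [hAk]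
    obtain hnk | hnk := lt_or_ge (n + k) 0
    · rw [hP.apply_fourierLp_of_neg hnk, sub_zero]
      exact Submodule.subset_span ⟨n + k, ⟨by omega, hnk⟩, rfl⟩
    · rw [hP.apply_fourierLp_of_nonneg hnk, sub_self]
      exact V.zero_mem
  have htop := Submodule.topologicalClosure_minimal _ hspan hV
  rw [span_fourierLp_closure_eq_top (by norm_num)] at htop
  exact htop (Submodule.mem_top (x := x))

/-- Hankel operators with continuous symbol are compact. -/
theorem isCompactOperator_hankel {P : CircleL2 →L[ℂ] CircleL2}
    {M : C(AddCircle (2 * Real.pi), ℂ) → (CircleL2 →L[ℂ] CircleL2)}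
    (hP : IsHardyProjection P) (hM : IsMultiplication M) (f : C(AddCircle (2 * Real.pi), ℂ)) :
    IsCompactOperator ((ContinuousLinearMap.id ℂ CircleL2 - P) ∘L M f ∘L P) := by
  let H : C(AddCircle (2 * Real.pi), ℂ) →L[ℂ] CircleL2 →L[ℂ] CircleL2 :=
    compL ℂ CircleL2 CircleL2 CircleL2 (ContinuousLinearMap.id ℂ CircleL2 - P) ∘L
      (compL ℂ CircleL2 CircleL2 CircleL2).flip P ∘L hM.toContinuousLinearMap
  have hclosed : IsClosed
      ((compactOperator (RingHom.id ℂ) CircleL2 CircleL2).comap H.toLinearMap :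
        Set C(AddCircle (2 * Real.pi), ℂ)) :=
    isClosed_setOfPred_isCompactOperator.preimage H.continuous
  have hspan : Submodule.span ℂ (Set.range fourier) ≤
      (compactOperator (RingHom.id ℂ) CircleL2 CircleL2).comap H.toLinearMap := by
    rw [Submodule.span_le]
    rintro _ ⟨n, rfl⟩
    exact isCompactOperator_hankel_fourier hP hM n
  have htop := Submodule.topologicalClosure_minimal _ hspan hclosed
  rw [span_fourier_closure_eq_top] at htop
  exact htop (Submodule.mem_top (x := f))

/-- **Semicommutators of Toeplitz operators are compact.**
Let `P₊` be the orthogonal projection of `L²` onto the Hardy space `H²`, and for a continuous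
symbol `f` let `M f` be the multiplication operator and `T_f = P₊ ∘ M f ∘ P₊` the Toeplitz
operator. Then for all continuous `f, g` the operator `T_f ∘ T_g − P₊ ∘ M (f·g) ∘ P₊` is a
compact operator on `L²`. -/
theorem toeplitz_semicommutator_compact
    (Pp : CircleL2 →L[ℂ] CircleL2)
    (hPp_mem : ∀ x ∈ hardySpace, Pp x = x)
    (hPp_orth : ∀ x ∈ hardySpaceᗮ, Pp x = 0)
    (M : C(AddCircle (2 * Real.pi), ℂ) → (CircleL2 →L[ℂ] CircleL2))
    (hM : ∀ (f : C(AddCircle (2 * Real.pi), ℂ)) (g : CircleL2),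
      (M f g : AddCircle (2 * Real.pi) → ℂ)
        =ᵐ[haarAddCircle (T := 2 * Real.pi)] fun x => f x * g x) :
    ∀ f g : C(AddCircle (2 * Real.pi), ℂ),
      IsCompactOperator
        ⇑((Pp ∘L M f ∘L Pp) ∘L (Pp ∘L M g ∘L Pp) - Pp ∘L M (f * g) ∘L Pp) := by
  intro f g
  have hP : IsHardyProjection Pp := ⟨hPp_mem, hPp_orth⟩
  have hsemi : (Pp ∘L M f ∘L Pp) ∘L (Pp ∘L M g ∘L Pp) - Pp ∘L M (f * g) ∘L Pp =
      -((Pp ∘L M f) ∘L ((ContinuousLinearMap.id ℂ CircleL2 - Pp) ∘L M g ∘L Pp)) := by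
    ext1 u
    simp only [comp_apply, sub_apply, neg_apply, id_apply, map_sub, hP.apply_apply,
      IsMultiplication.map_mul_apply hM, neg_sub]
  rw [hsemi]
  exact ((isCompactOperator_hankel hP hM g).clm_comp (Pp ∘L M f)).neg
end

section
/- Let Θ be a real number, let p, q be integers with p − q·Θ > 0, and let ((p_k, q_k))_{k ∈ F} be a finite family of pairs of integers forming a partition of (p, q), i.e. Σ_k p_k = p, Σ_k q_k = q, and p_k − q_k·Θ > 0 for every k ∈ F. Then Σ_{k ∈ F} q_k² / (p_k − q_k·Θ) ≥ q² / (p − q·Θ). (Hence among all instanton partitions the trivial partition {(p,q)} minimizes the Yang–Mills action (4π²/τ)·Σ_k q_k²/(p_k − q_kΘ), so the constant curvature connection is the global minimum of the Yang–Mills functional on the Heisenberg module ℰ_{p,q}.) -/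
/-- **The trivial partition minimizes the Yang–Mills action on a Heisenberg module.**
If `p − qΘ > 0` and `((p_k, q_k))_k` is a finite partition of `(p, q)` with `p_k − q_kΘ > 0`
for all `k`, then `Σ_k q_k²/(p_k − q_kΘ) ≥ q²/(p − qΘ)`. -/
theorem trivial_partition_minimizes_yang_mills
    (Θ : ℝ) (p q : ℤ) (hpq : (p : ℝ) - (q : ℝ) * Θ > 0)
    (ι : Type*) [Fintype ι] (pk qk : ι → ℤ)
    (hk : ∀ k, (pk k : ℝ) - (qk k : ℝ) * Θ > 0)
    (hp : ∑ k, pk k = p) (hq : ∑ k, qk k = q) :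
    ∑ k, (qk k : ℝ) ^ 2 / ((pk k : ℝ) - (qk k : ℝ) * Θ)
      ≥ (q : ℝ) ^ 2 / ((p : ℝ) - (q : ℝ) * Θ) := by
  subst hp hq
  push_cast
  rw [Finset.sum_mul, ← Finset.sum_sub_distrib]
  exact Finset.sq_sum_div_le_sum_sq_div _ _ fun k _ => hk k
end
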